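/- Let γ : ℝ → ℝ be nonnegative and nondecreasing on [0,∞), differentiable at every point of (1,∞), with γ(1) > 0, and let δ > 0. Then the set E_δ = { t ∈ (1,∞) : γ'(t) > γ(t)^{1+δ} } has Lebesgue measure at most δ⁻¹·γ(1)^{−δ}; in particular, E_δ has finite Lebesgue measure. -/

import Mathlib

open MeasureTheory Real Set

/-- If `g` is nondecreasing and differentiable on `(a,∞)` with values in `[c,d]`, then the set
where its derivative is at least `1` has measure at most `d - c`. -/
theorem volume_one_le_deriv_le_of_monotoneOn {g : ℝ → ℝ} {a c d : ℝ}
    (hmono : MonotoneOn g (Ioi a)) (hdiff : ∀ t ∈ Ioi a, DifferentiableAt ℝ g t)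
    (hmaps : MapsTo g (Ioi a) (Icc c d)) :
    volume {t : ℝ | t ∈ Ioi a ∧ 1 ≤ deriv g t} ≤ ENNReal.ofReal (d - c) := by
  have hset : {t : ℝ | t ∈ Ioi a ∧ 1 ≤ deriv g t}
      = {t | 1 ≤ ENNReal.ofReal (deriv g t)} ∩ Ioi a := by
    ext t
    simp [and_comm]
  calc volume {t : ℝ | t ∈ Ioi a ∧ 1 ≤ deriv g t}
      = volume.restrict (Ioi a) {t | 1 ≤ ENNReal.ofReal (deriv g t)} := by
        rw [hset, Measure.restrict_apply' measurableSet_Ioi]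
    _ ≤ ∫⁻ t in Ioi a, ENNReal.ofReal (deriv g t) := by
        simpa using mul_meas_ge_le_lintegral (μ := volume.restrict (Ioi a))
          (measurable_deriv g).ennreal_ofReal 1
    _ = volume (g '' Ioi a) :=
        lintegral_deriv_eq_volume_image_of_monotoneOn measurableSet_Ioi
          (fun t ht => (hdiff t ht).hasDerivAt.hasDerivWithinAt) hmono
    _ ≤ volume (Icc c d) := measure_mono hmaps.image_subset
    _ = ENNReal.ofReal (d - c) := Real.volume_Icc

/-- Deterministic core of the Calculus Lemma: if `γ` is nonnegative and nondecreasing on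
`[0,∞)`, differentiable on `(1,∞)`, with `γ 1 > 0`, then for `δ > 0` the exceptional set
`E_δ = {t ∈ (1,∞) : γ'(t) > γ(t)^(1+δ)}` has Lebesgue measure at most `δ⁻¹ * γ 1 ^ (-δ)`;
in particular it has finite Lebesgue measure. -/
theorem calculus_lemma_exceptional_set (γ : ℝ → ℝ) (δ : ℝ)
    (hnn : ∀ t ∈ Set.Ici (0:ℝ), 0 ≤ γ t)
    (hmono : MonotoneOn γ (Set.Ici (0:ℝ)))
    (hdiff : ∀ t ∈ Set.Ioi (1:ℝ), DifferentiableAt ℝ γ t)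
    (hγ1 : 0 < γ 1) (hδ : 0 < δ) :
    volume {t : ℝ | t ∈ Set.Ioi (1:ℝ) ∧ deriv γ t > γ t ^ (1 + δ)}
      ≤ ENNReal.ofReal (δ⁻¹ * γ 1 ^ (-δ)) ∧
    volume {t : ℝ | t ∈ Set.Ioi (1:ℝ) ∧ deriv γ t > γ t ^ (1 + δ)} < ⊤ := by
  suffices h : volume {t : ℝ | t ∈ Set.Ioi (1:ℝ) ∧ deriv γ t > γ t ^ (1 + δ)}
      ≤ ENNReal.ofReal (δ⁻¹ * γ 1 ^ (-δ)) from ⟨h, h.trans_lt ENNReal.ofReal_lt_top⟩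
  have hle : ∀ t ∈ Ioi (1:ℝ), γ 1 ≤ γ t := fun t ht =>
    hmono (by simp) (mem_Ici.2 (zero_le_one.trans (le_of_lt ht))) (le_of_lt ht)
  have hpos : ∀ t ∈ Ioi (1:ℝ), 0 < γ t := fun t ht => hγ1.trans_le (hle t ht)
  have hderiv : ∀ t ∈ Ioi (1:ℝ),
      HasDerivAt (fun s => -(δ⁻¹ * γ s ^ (-δ))) (deriv γ t * γ t ^ (-(1 + δ))) t := by
    intro t ht
    refine (((hdiff t ht).hasDerivAt.rpow_const (p := -δ)
      (Or.inl (hpos t ht).ne')).const_mul δ⁻¹).fun_neg.congr_deriv ?_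
    rw [show -δ - 1 = -(1 + δ) by ring]
    field_simp
  have hpow : ∀ x y : ℝ, 0 < x → x ≤ y → δ⁻¹ * y ^ (-δ) ≤ δ⁻¹ * x ^ (-δ) := fun x y hx hxy =>
    mul_le_mul_of_nonneg_left (rpow_le_rpow_of_nonpos hx hxy (neg_nonpos.2 hδ.le))
      (inv_nonneg.2 hδ.le)
  have hmain := volume_one_le_deriv_le_of_monotoneOn
    (g := fun s => -(δ⁻¹ * γ s ^ (-δ))) (a := 1) (c := -(δ⁻¹ * γ 1 ^ (-δ))) (d := 0)
    (fun s hs t ht hst => neg_le_neg (hpow _ _ (hpos s hs)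
      (hmono (mem_Ici.2 (zero_le_one.trans (le_of_lt hs)))
        (mem_Ici.2 (zero_le_one.trans (le_of_lt ht))) hst)))
    (fun t ht => (hderiv t ht).differentiableAt)
    (fun t ht => ⟨neg_le_neg (hpow _ _ hγ1 (hle t ht)),
      neg_nonpos.2 (mul_nonneg (inv_nonneg.2 hδ.le) (rpow_nonneg (hpos t ht).le _))⟩)
  rw [zero_sub, neg_neg] at hmain
  refine (measure_mono ?_).trans hmain
  rintro t ⟨ht, hlt⟩
  refine ⟨ht, ?_⟩
  rw [(hderiv t ht).deriv, rpow_neg (hpos t ht).le, ← div_eq_mul_inv,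
    one_le_div (rpow_pos_of_pos (hpos t ht) _)]
  exact hlt.le
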